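/- arXiv:1603.08758 — 2 statements merged into one kernel-verified Lean document; each statement's English description precedes it below -/
import Mathlib

section
/- If ε_{ij} = 1 for all i ≠ j in I, then for every i ∈ I^n the set NC^ε[i] factorizes over the blocks of ker i: a partition π of {1,…,n} with π ≤ ker i belongs to NC^ε[i] if and only if for every block V of ker i the restriction of π to V is a non-crossing partition of V (with respect to the order induced from {1,…,n}). Consequently, the map π ↦ (π restricted to V)_{V ∈ ker i} is a bijection from NC^ε[i] onto the product ∏_{V ∈ ker i} NC(V) of the sets of non-crossing partitions of the blocks of ker i. -/
open Finset

/-- `p` and `q` lie in a common block of `P`. -/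
def SameBlock {n : ℕ} (P : Finset (Finset (Fin n))) (p q : Fin n) : Prop :=
  ∃ V ∈ P, p ∈ V ∧ q ∈ V

/-- `P` is a partition of `{1,…,n}` (modelled on `Fin n`): its blocks are nonempty and
every point lies in exactly one block. -/
def IsPartition {n : ℕ} (P : Finset (Finset (Fin n))) : Prop :=
  (∅ ∉ P) ∧ ∀ k : Fin n, ∃! V, V ∈ P ∧ k ∈ V

/-- `P ≤ ker idx`: every block of `P` is contained in a level set of `idx`. -/
def LeKer {I : Type*} {n : ℕ} (idx : Fin n → I) (P : Finset (Finset (Fin n))) : Prop :=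
  ∀ p q, SameBlock P p q → idx p = idx q

/-- `P` is `(ε, idx)`-non-crossing: every crossing of two blocks happens at indices
`i, j` with `ε i j = 1`. -/
def IsEpsNC {I : Type*} (ε : I → I → Bool) {n : ℕ} (idx : Fin n → I)
    (P : Finset (Finset (Fin n))) : Prop :=
  ∀ p₁ q₁ p₂ q₂ : Fin n, p₁ < q₁ → q₁ < p₂ → p₂ < q₂ →
    SameBlock P p₁ p₂ → SameBlock P q₁ q₂ → ¬ SameBlock P p₁ q₁ →
    ε (idx p₁) (idx q₁) = true

/-- `NC^ε[idx]`: the partitions `P ≤ ker idx` that are `(ε, idx)`-non-crossing. -/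
def NCeps {I : Type*} (ε : I → I → Bool) {n : ℕ} (idx : Fin n → I) :
    Set (Finset (Finset (Fin n))) :=
  {P | IsPartition P ∧ LeKer idx P ∧ IsEpsNC ε idx P}

/-- `P` is non-crossing. -/
def IsNonCrossing {n : ℕ} (P : Finset (Finset (Fin n))) : Prop :=
  ∀ p₁ q₁ p₂ q₂ : Fin n, p₁ < q₁ → q₁ < p₂ → p₂ < q₂ →
    SameBlock P p₁ p₂ → SameBlock P q₁ q₂ → SameBlock P p₁ q₁

/-- `NC(n)`: the set of non-crossing partitions of `{1,…,n}`. -/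
def NCset (n : ℕ) : Set (Finset (Finset (Fin n))) :=
  {P | IsPartition P ∧ IsNonCrossing P}

/-- `ker idx`: the kernel partition of the tuple `idx`, whose blocks are the level
sets of `idx`. -/
def kerPart {I : Type*} [DecidableEq I] {n : ℕ} (idx : Fin n → I) :
    Finset (Finset (Fin n)) :=
  Finset.univ.image fun k => Finset.univ.filter fun l => idx l = idx k

/-- `Q` is a partition of the finite set `V ⊆ {1,…,n}`. -/
def IsPartitionOn {n : ℕ} (V : Finset (Fin n)) (Q : Finset (Finset (Fin n))) : Prop :=
  (∅ ∉ Q) ∧ (∀ W ∈ Q, W ⊆ V) ∧ ∀ k ∈ V, ∃! W, W ∈ Q ∧ k ∈ W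

theorem mem_iff_of_mem_kerPart {I : Type*} [DecidableEq I] {n : ℕ} {idx : Fin n → I}
    {V : Finset (Fin n)} (hV : V ∈ kerPart idx) {p : Fin n} (hp : p ∈ V) (q : Fin n) :
    q ∈ V ↔ idx q = idx p := by
  obtain ⟨k, -, rfl⟩ := Finset.mem_image.1 hV
  simp only [Finset.mem_filter, Finset.mem_univ, true_and] at hp ⊢
  rw [hp]

theorem exists_mem_kerPart {I : Type*} [DecidableEq I] {n : ℕ} (idx : Fin n → I) (p : Fin n) :
    ∃ V ∈ kerPart idx, p ∈ V :=
  ⟨_, Finset.mem_image_of_mem _ (Finset.mem_univ p), by simp⟩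

theorem eq_of_mem_kerPart {I : Type*} [DecidableEq I] {n : ℕ} {idx : Fin n → I}
    {V V' : Finset (Fin n)} (hV : V ∈ kerPart idx) (hV' : V' ∈ kerPart idx) {p : Fin n}
    (hp : p ∈ V) (hp' : p ∈ V') : V = V' := by
  ext q
  rw [mem_iff_of_mem_kerPart hV hp, mem_iff_of_mem_kerPart hV' hp']

theorem LeKer.subset {I : Type*} [DecidableEq I] {n : ℕ} {idx : Fin n → I}
    {P : Finset (Finset (Fin n))} (hP : LeKer idx P) {V W : Finset (Fin n)}
    (hV : V ∈ kerPart idx) (hW : W ∈ P) {p : Fin n} (hpW : p ∈ W) (hpV : p ∈ V) : W ⊆ V :=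
  fun q hq => (mem_iff_of_mem_kerPart hV hpV q).2 (hP q p ⟨W, hW, hq, hpW⟩)

theorem LeKer.sameBlock_filter_iff {I : Type*} [DecidableEq I] {n : ℕ} {idx : Fin n → I}
    {P : Finset (Finset (Fin n))} (hP : LeKer idx P) {V : Finset (Fin n)}
    (hV : V ∈ kerPart idx) (p q : Fin n) :
    SameBlock (P.filter fun W => W ⊆ V) p q ↔ SameBlock P p q ∧ p ∈ V := by
  constructor
  · rintro ⟨W, hW, hp, hq⟩
    rw [Finset.mem_filter] at hW
    exact ⟨⟨W, hW.1, hp, hq⟩, hW.2 hp⟩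
  · rintro ⟨⟨W, hW, hp, hq⟩, hpV⟩
    exact ⟨W, Finset.mem_filter.2 ⟨hW, hP.subset hV hW hp hpV⟩, hp, hq⟩

theorem LeKer.isEpsNC_iff {I : Type*} [DecidableEq I] {ε : I → I → Bool}
    (hdiag : ∀ i, ε i i = false) (hone : ∀ i j, i ≠ j → ε i j = true)
    {n : ℕ} {idx : Fin n → I} {P : Finset (Finset (Fin n))} (hP : LeKer idx P) :
    IsEpsNC ε idx P ↔ ∀ V ∈ kerPart idx, IsNonCrossing (P.filter fun W => W ⊆ V) := by
  constructor
  · intro h V hV p₁ q₁ p₂ q₂ h₁ h₂ h₃ hp hq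
    rw [hP.sameBlock_filter_iff hV] at hp hq ⊢
    refine ⟨?_, hp.2⟩
    by_contra hpq
    have hε := h p₁ q₁ p₂ q₂ h₁ h₂ h₃ hp.1 hq.1 hpq
    rw [(mem_iff_of_mem_kerPart hV hp.2 q₁).1 hq.2, hdiag] at hε
    exact Bool.false_ne_true hε
  · intro h p₁ q₁ p₂ q₂ h₁ h₂ h₃ hp hq hpq
    refine hone _ _ fun heq => hpq ?_
    obtain ⟨V, hV, hpV⟩ := exists_mem_kerPart idx p₁
    have hqV := (mem_iff_of_mem_kerPart hV hpV q₁).2 heq.symm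
    have hNC := h V hV p₁ q₁ p₂ q₂ h₁ h₂ h₃
    simp only [hP.sameBlock_filter_iff hV] at hNC
    exact (hNC ⟨hp, hpV⟩ ⟨hq, hqV⟩).1

theorem IsPartition.isPartitionOn_filter {I : Type*} [DecidableEq I] {n : ℕ} {idx : Fin n → I}
    {P : Finset (Finset (Fin n))} (hP : IsPartition P) (hle : LeKer idx P)
    {V : Finset (Fin n)} (hV : V ∈ kerPart idx) :
    IsPartitionOn V (P.filter fun W => W ⊆ V) := by
  refine ⟨fun h => hP.1 (Finset.mem_filter.1 h).1, fun W hW => (Finset.mem_filter.1 hW).2,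
    fun k hk => ?_⟩
  obtain ⟨W, ⟨hW, hkW⟩, huniq⟩ := hP.2 k
  exact ⟨W, ⟨Finset.mem_filter.2 ⟨hW, hle.subset hV hW hkW hk⟩, hkW⟩,
    fun W' hW' => huniq W' ⟨(Finset.mem_filter.1 hW'.1).1, hW'.2⟩⟩

theorem IsPartition.exists_subset_kerPart {I : Type*} [DecidableEq I] {n : ℕ} {idx : Fin n → I}
    {P : Finset (Finset (Fin n))} (hP : IsPartition P) (hle : LeKer idx P)
    {W : Finset (Fin n)} (hW : W ∈ P) : ∃ V ∈ kerPart idx, W ⊆ V := by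
  obtain ⟨k, hk⟩ := Finset.nonempty_iff_ne_empty.2 fun h : W = ∅ => hP.1 (h ▸ hW)
  obtain ⟨V, hV, hkV⟩ := exists_mem_kerPart idx k
  exact ⟨V, hV, hle.subset hV hW hk hkV⟩

theorem IsPartition.subset_of_filter_eq {I : Type*} [DecidableEq I] {n : ℕ} {idx : Fin n → I}
    {P Q : Finset (Finset (Fin n))} (hP : IsPartition P) (hle : LeKer idx P)
    (h : ∀ V ∈ kerPart idx, (P.filter fun W => W ⊆ V) = Q.filter fun W => W ⊆ V) : P ⊆ Q := by
  intro W hW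
  obtain ⟨V, hV, hWV⟩ := hP.exists_subset_kerPart hle hW
  have hmem : W ∈ P.filter fun W => W ⊆ V := Finset.mem_filter.2 ⟨hW, hWV⟩
  rw [h V hV] at hmem
  exact (Finset.mem_filter.1 hmem).1

/-- Partitions of the blocks of `ker idx` glue to a partition of `{1,…,n}` below `ker idx`. -/
theorem exists_isPartition_filter_eq {I : Type*} [DecidableEq I] {n : ℕ} {idx : Fin n → I}
    {g : {V // V ∈ kerPart idx} → Finset (Finset (Fin n))}
    (hg : ∀ V, IsPartitionOn V.1 (g V)) :
    ∃ P : Finset (Finset (Fin n)), IsPartition P ∧ LeKer idx P ∧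
      ∀ V, (P.filter fun W => W ⊆ V.1) = g V := by
  refine ⟨Finset.univ.biUnion g, ⟨?_, fun k => ?_⟩, ?_, fun V => ?_⟩
  · simpa using fun V hV => (hg ⟨V, hV⟩).1
  · obtain ⟨V, hV, hkV⟩ := exists_mem_kerPart idx k
    obtain ⟨W, ⟨hW, hkW⟩, huniq⟩ := (hg ⟨V, hV⟩).2.2 k hkV
    refine ⟨W, ⟨Finset.mem_biUnion.2 ⟨_, Finset.mem_univ _, hW⟩, hkW⟩, ?_⟩
    rintro W' ⟨hW', hkW'⟩
    obtain ⟨⟨V', hV'⟩, -, hWV'⟩ := Finset.mem_biUnion.1 hW'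
    obtain rfl := eq_of_mem_kerPart hV hV' hkV ((hg ⟨V', hV'⟩).2.1 W' hWV' hkW')
    exact huniq W' ⟨hWV', hkW'⟩
  · rintro p q ⟨W, hW, hp, hq⟩
    obtain ⟨V, -, hWV⟩ := Finset.mem_biUnion.1 hW
    have hsub := (hg V).2.1 W hWV
    exact (mem_iff_of_mem_kerPart V.2 (hsub hq) p).1 (hsub hp)
  · ext W
    rw [Finset.mem_filter, Finset.mem_biUnion]
    constructor
    · rintro ⟨⟨V', -, hWV'⟩, hWV⟩
      obtain ⟨k, hk⟩ := Finset.nonempty_iff_ne_empty.2 fun h : W = ∅ => (hg V').1 (h ▸ hWV')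
      obtain rfl : V = V' :=
        Subtype.ext (eq_of_mem_kerPart V.2 V'.2 (hWV hk) ((hg V').2.1 W hWV' hk))
      exact hWV'
    · exact fun hW => ⟨⟨V, Finset.mem_univ _, hW⟩, (hg V).2.1 W hW⟩

/-- If `ε_{ij} = 1` for all `i ≠ j`, then `NC^ε[idx]` factorizes over
the blocks of `ker idx`: a partition `P ≤ ker idx` lies in `NC^ε[idx]` iff its
restriction to each block `V` of `ker idx` (which is `{W ∈ P | W ⊆ V}`) is
non-crossing; moreover, the restriction map is a bijection from `NC^ε[idx]` onto the
product, over the blocks `V` of `ker idx`, of the sets of non-crossing partitions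
of `V`. -/
theorem NCeps_of_eps_one_factorizes {I : Type*} [DecidableEq I] (ε : I → I → Bool)
    (hsym : ∀ i j, ε i j = ε j i) (hdiag : ∀ i, ε i i = false)
    (hone : ∀ i j, i ≠ j → ε i j = true)
    (n : ℕ) (idx : Fin n → I) :
    (∀ P : Finset (Finset (Fin n)), IsPartition P → LeKer idx P →
      (P ∈ NCeps ε idx ↔
        ∀ V ∈ kerPart idx, IsNonCrossing (P.filter fun W => W ⊆ V))) ∧
    Set.BijOn
      (fun (P : Finset (Finset (Fin n))) (V : {V // V ∈ kerPart idx}) =>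
        P.filter fun W => W ⊆ V.1)
      (NCeps ε idx)
      {g | ∀ V : {V // V ∈ kerPart idx}, IsPartitionOn V.1 (g V) ∧ IsNonCrossing (g V)} := by
  refine ⟨fun P hP hle => ?_, fun P hP V => ?_, fun P hP Q hQ hPQ => ?_, fun g hg => ?_⟩
  · rw [← hle.isEpsNC_iff hdiag hone]
    exact ⟨fun h => h.2.2, fun h => ⟨hP, hle, h⟩⟩
  · exact ⟨hP.1.isPartitionOn_filter hP.2.1 V.2,
      (hP.2.1.isEpsNC_iff hdiag hone).1 hP.2.2 V.1 V.2⟩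
  · have h : ∀ V ∈ kerPart idx, (P.filter fun W => W ⊆ V) = Q.filter fun W => W ⊆ V :=
      fun V hV => congrFun hPQ ⟨V, hV⟩
    exact (hP.1.subset_of_filter_eq hP.2.1 h).antisymm
      (hQ.1.subset_of_filter_eq hQ.2.1 fun V hV => (h V hV).symm)
  · obtain ⟨P, hP, hle, hPg⟩ := exists_isPartition_filter_eq fun V => (hg V).1
    refine ⟨P, ⟨hP, hle, (hle.isEpsNC_iff hdiag hone).2 fun V hV => ?_⟩, funext hPg⟩
    rw [hPg ⟨V, hV⟩]
    exact (hg ⟨V, hV⟩).2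
end

section
/- Let i ∈ I^n and let π be a partition of {1,…,n} with π ≤ ker i. Then π is (ε,i)-non-crossing if and only if the pair (π, i) can be reduced to the empty partition of the empty tuple by iterating the following two operations: (1) removal of an interval block: if π = π̃ ∪ {(r, r+1, …, r+p)} where (r, r+1, …, r+p) is a block of π consisting of consecutive elements, replace (π, i) by (π̃, (i(1),…,i(r−1),i(r+p+1),…,i(n))); (2) adjacent swap: if ε_{i(k)i(k+1)} = 1, replace (π, (i(1),…,i(k),i(k+1),…,i(n))) by (π_{k↔k+1}, (i(1),…,i(k+1),i(k),…,i(n))), where π_{k↔k+1} is obtained from π by exchanging the points k and k+1. -/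
open Finset

/-- The order-embedding of `Fin (n - (s - r + 1))` into `Fin n` that skips the
interval `{r, …, s}`; it reindexes the points remaining after the removal of an
interval block. -/
def skipIcc {n : ℕ} (r s : Fin n) : Fin (n - ((s : ℕ) - (r : ℕ) + 1)) → Fin n :=
  fun j =>
    if hj : (j : ℕ) < (r : ℕ) then ⟨j, Nat.lt_trans hj r.isLt⟩
    else ⟨(j : ℕ) + ((s : ℕ) - (r : ℕ) + 1), by have h1 := j.isLt; omega⟩

lemma skipIcc_injective {n : ℕ} (r s : Fin n) : Function.Injective (skipIcc r s) := by
  intro a b hab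
  have hv := congrArg Fin.val hab
  unfold skipIcc at hv
  apply Fin.ext
  split_ifs at hv <;> simp_all <;> omega

/-- The pair `(idx, P)` can be reduced to the empty partition of the empty tuple by
iterating the two operations: (1) removal of an interval block `{r, r+1, …, s}` of `P`
(deleting the corresponding entries of the tuple), and (2) exchange of two adjacent
points `k, k+1` (in the partition and in the tuple) whenever
`ε_{idx k, idx (k+1)} = 1`. -/
inductive EpsReducible {I : Type*} (ε : I → I → Bool) :
    ∀ {n : ℕ}, (Fin n → I) → Finset (Finset (Fin n)) → Prop
  | empty (idx : Fin 0 → I) : EpsReducible ε idx ∅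
  | removeInterval {n : ℕ} (idx : Fin n → I) (P : Finset (Finset (Fin n)))
      (r s : Fin n) (hrs : r ≤ s) (hB : Finset.Icc r s ∈ P)
      (htail : EpsReducible ε (idx ∘ skipIcc r s)
        ((P.erase (Finset.Icc r s)).image
          (fun V => V.preimage (skipIcc r s) (skipIcc_injective r s).injOn))) :
      EpsReducible ε idx P
  | swap {n : ℕ} (idx : Fin n → I) (P : Finset (Finset (Fin n)))
      (k : Fin n) (hk : (k : ℕ) + 1 < n)
      (hε : ε (idx k) (idx ⟨(k : ℕ) + 1, hk⟩) = true)
      (htail : EpsReducible ε (idx ∘ (Equiv.swap k ⟨(k : ℕ) + 1, hk⟩))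
        (P.image (Finset.image (Equiv.swap k ⟨(k : ℕ) + 1, hk⟩)))) :
      EpsReducible ε idx P

section SkipIcc

variable {n : ℕ} {r s : Fin n}

lemma skipIcc_strictMono (r s : Fin n) : StrictMono (skipIcc r s) := by
  intro a b hab
  have hab' : (a : ℕ) < b := hab
  rw [Fin.lt_def]
  unfold skipIcc
  split_ifs <;> simp <;> omega

lemma skipIcc_notMem_Icc (hrs : r ≤ s) (j) : skipIcc r s j ∉ Finset.Icc r s := by
  have hrs' : (r : ℕ) ≤ s := hrs
  rw [Finset.mem_Icc, Fin.le_def, Fin.le_def]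
  unfold skipIcc
  split_ifs <;> simp <;> omega

lemma exists_skipIcc_eq (hrs : r ≤ s) {x : Fin n} (hx : x ∉ Finset.Icc r s) :
    ∃ j, skipIcc r s j = x := by
  have hrs' : (r : ℕ) ≤ s := hrs
  have hxn := x.isLt
  have hsn := s.isLt
  rw [Finset.mem_Icc, Fin.le_def, Fin.le_def] at hx
  by_cases hxr : (x : ℕ) < r
  · refine ⟨⟨x, by omega⟩, Fin.ext ?_⟩
    simp [skipIcc, hxr]
  · refine ⟨⟨x - ((s : ℕ) - r + 1), by omega⟩, Fin.ext ?_⟩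
    unfold skipIcc
    split_ifs with h
    · simp at h
      omega
    · simp
      omega

end SkipIcc

section Partition

variable {n : ℕ} {P : Finset (Finset (Fin n))}

lemma SameBlock.symm {p q : Fin n} (h : SameBlock P p q) : SameBlock P q p := by
  obtain ⟨V, hV, hp, hq⟩ := h
  exact ⟨V, hV, hq, hp⟩

lemma IsPartition.eq_of_mem (hP : IsPartition P) {V W : Finset (Fin n)} {x : Fin n}
    (hV : V ∈ P) (hW : W ∈ P) (hxV : x ∈ V) (hxW : x ∈ W) : V = W :=
  (hP.2 x).unique ⟨hV, hxV⟩ ⟨hW, hxW⟩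

lemma IsPartition.mem_of_sameBlock (hP : IsPartition P) {V : Finset (Fin n)} {p q : Fin n}
    (hV : V ∈ P) (hpV : p ∈ V) (h : SameBlock P p q) : q ∈ V := by
  obtain ⟨W, hW, hp, hq⟩ := h
  rwa [hP.eq_of_mem hV hW hpV hp]

lemma IsPartition.eq_empty {P : Finset (Finset (Fin 0))} (hP : IsPartition P) : P = ∅ := by
  refine Finset.eq_empty_of_forall_notMem fun V hV => hP.1 ?_
  rwa [Subsingleton.elim ∅ V]

end Partition

/-- The partition left after deleting the block `{r, …, s}` from `P`, with its points
reindexed along `skipIcc r s`. -/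
noncomputable abbrev eraseIcc {n : ℕ} (P : Finset (Finset (Fin n))) (r s : Fin n) :
    Finset (Finset (Fin (n - ((s : ℕ) - (r : ℕ) + 1)))) :=
  (P.erase (Finset.Icc r s)).image
    (fun V => V.preimage (skipIcc r s) (skipIcc_injective r s).injOn)

section EraseIcc

variable {I : Type*} {ε : I → I → Bool} {n : ℕ} {idx : Fin n → I}
  {P : Finset (Finset (Fin n))} {r s : Fin n}

lemma sameBlock_eraseIcc (hrs : r ≤ s) {p q} :
    SameBlock (eraseIcc P r s) p q ↔ SameBlock P (skipIcc r s p) (skipIcc r s q) := by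
  constructor
  · rintro ⟨V, hV, hp, hq⟩
    obtain ⟨W, hW, rfl⟩ := Finset.mem_image.1 hV
    exact ⟨W, Finset.mem_of_mem_erase hW, Finset.mem_preimage.1 hp, Finset.mem_preimage.1 hq⟩
  · rintro ⟨V, hV, hp, hq⟩
    refine ⟨_, Finset.mem_image_of_mem _ (Finset.mem_erase.2 ⟨?_, hV⟩),
      Finset.mem_preimage.2 hp, Finset.mem_preimage.2 hq⟩
    rintro rfl
    exact skipIcc_notMem_Icc hrs p hp

lemma IsPartition.eraseIcc (hP : IsPartition P) (hrs : r ≤ s) (hB : Finset.Icc r s ∈ P) :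
    IsPartition (eraseIcc P r s) := by
  constructor
  · intro h
    obtain ⟨V, hV, hV0⟩ := Finset.mem_image.1 h
    obtain ⟨hne, hVP⟩ := Finset.mem_erase.1 hV
    obtain ⟨x, hx⟩ := Finset.nonempty_iff_ne_empty.2 (ne_of_mem_of_not_mem hVP hP.1)
    obtain ⟨j, rfl⟩ := exists_skipIcc_eq hrs
      (fun hxI => hne (hP.eq_of_mem hVP hB hx hxI))
    exact Finset.notMem_empty j (hV0 ▸ Finset.mem_preimage.2 hx)
  · intro k
    obtain ⟨V, ⟨hV, hk⟩, -⟩ := hP.2 (skipIcc r s k)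
    obtain ⟨W, hW, hkW, -⟩ := (sameBlock_eraseIcc hrs).2 ⟨V, hV, hk, hk⟩
    refine ⟨W, ⟨hW, hkW⟩, ?_⟩
    rintro W' ⟨hW', hkW'⟩
    obtain ⟨U, hU, rfl⟩ := Finset.mem_image.1 hW
    obtain ⟨U', hU', rfl⟩ := Finset.mem_image.1 hW'
    rw [hP.eq_of_mem (Finset.mem_of_mem_erase hU) (Finset.mem_of_mem_erase hU')
      (Finset.mem_preimage.1 hkW) (Finset.mem_preimage.1 hkW')]

lemma LeKer.eraseIcc (hker : LeKer idx P) (hrs : r ≤ s) :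
    LeKer (idx ∘ skipIcc r s) (eraseIcc P r s) :=
  fun _ _ h => hker _ _ ((sameBlock_eraseIcc hrs).1 h)

lemma IsEpsNC.eraseIcc (h : IsEpsNC ε idx P) (hrs : r ≤ s) :
    IsEpsNC ε (idx ∘ skipIcc r s) (eraseIcc P r s) := by
  intro p₁ q₁ p₂ q₂ h₁ h₂ h₃ hp hq hpq
  rw [sameBlock_eraseIcc hrs] at hp hq hpq
  have hmono := skipIcc_strictMono r s
  exact h _ _ _ _ (hmono h₁) (hmono h₂) (hmono h₃) hp hq hpq

lemma IsEpsNC.of_eraseIcc (hP : IsPartition P) (hrs : r ≤ s) (hB : Finset.Icc r s ∈ P)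
    (h : IsEpsNC ε (idx ∘ skipIcc r s) (_root_.eraseIcc P r s)) : IsEpsNC ε idx P := by
  intro p₁ q₁ p₂ q₂ h₁ h₂ h₃ hp hq hpq
  have between {x y z : Fin n} (hxy : x < y) (hyz : y < z) (hx : x ∈ Finset.Icc r s)
      (hz : z ∈ Finset.Icc r s) : y ∈ Finset.Icc r s :=
    Finset.mem_Icc.2 ⟨(Finset.mem_Icc.1 hx).1.trans hxy.le,
      hyz.le.trans (Finset.mem_Icc.1 hz).2⟩
  have hp₁ : p₁ ∉ Finset.Icc r s := fun hm =>
    hpq ⟨_, hB, hm, between h₁ h₂ hm (hP.mem_of_sameBlock hB hm hp)⟩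
  have hp₂ : p₂ ∉ Finset.Icc r s := fun hm => hp₁ (hP.mem_of_sameBlock hB hm hp.symm)
  have hq₁ : q₁ ∉ Finset.Icc r s := fun hm =>
    hp₂ (between h₂ h₃ hm (hP.mem_of_sameBlock hB hm hq))
  have hq₂ : q₂ ∉ Finset.Icc r s := fun hm => hq₁ (hP.mem_of_sameBlock hB hm hq.symm)
  obtain ⟨p₁, rfl⟩ := exists_skipIcc_eq hrs hp₁
  obtain ⟨p₂, rfl⟩ := exists_skipIcc_eq hrs hp₂
  obtain ⟨q₁, rfl⟩ := exists_skipIcc_eq hrs hq₁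
  obtain ⟨q₂, rfl⟩ := exists_skipIcc_eq hrs hq₂
  have hmono := skipIcc_strictMono r s
  rw [← sameBlock_eraseIcc hrs] at hp hq hpq
  exact h p₁ q₁ p₂ q₂ (hmono.lt_iff_lt.1 h₁) (hmono.lt_iff_lt.1 h₂) (hmono.lt_iff_lt.1 h₃)
    hp hq hpq

end EraseIcc

section Relabel

variable {I : Type*} {n : ℕ} {idx : Fin n → I} {P : Finset (Finset (Fin n))}

lemma mem_image_equiv_iff (σ : Equiv.Perm (Fin n)) {V : Finset (Fin n)} {x : Fin n} :
    x ∈ V.image σ ↔ σ.symm x ∈ V := by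
  rw [← Finset.mem_map_equiv, Finset.map_eq_image]
  rfl

lemma sameBlock_image_equiv (σ : Equiv.Perm (Fin n)) {p q : Fin n} :
    SameBlock (P.image (Finset.image σ)) p q ↔ SameBlock P (σ.symm p) (σ.symm q) := by
  simp only [SameBlock, Finset.exists_mem_image, mem_image_equiv_iff]

lemma IsPartition.image_equiv (hP : IsPartition P) (σ : Equiv.Perm (Fin n)) :
    IsPartition (P.image (Finset.image σ)) := by
  constructor
  · intro h
    obtain ⟨V, hV, hV0⟩ := Finset.mem_image.1 h
    exact hP.1 (Finset.image_eq_empty.1 hV0 ▸ hV)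
  · intro k
    obtain ⟨V, ⟨hV, hk⟩, -⟩ := hP.2 (σ.symm k)
    refine ⟨V.image σ, ⟨Finset.mem_image_of_mem _ hV, (mem_image_equiv_iff σ).2 hk⟩, ?_⟩
    rintro W ⟨hW, hkW⟩
    obtain ⟨U, hU, rfl⟩ := Finset.mem_image.1 hW
    rw [hP.eq_of_mem hU hV ((mem_image_equiv_iff σ).1 hkW) hk]

lemma LeKer.image_equiv (hker : LeKer idx P) (σ : Equiv.Perm (Fin n)) :
    LeKer (idx ∘ σ.symm) (P.image (Finset.image σ)) :=
  fun _ _ h => hker _ _ ((sameBlock_image_equiv σ).1 h)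

end Relabel

section AdjacentSwap

variable {I : Type*} {ε : I → I → Bool} {n : ℕ} {idx : Fin n → I}
  {P : Finset (Finset (Fin n))} {k l : Fin n}

lemma swap_lt_swap_or_eq {x y : Fin n} (hkl : (l : ℕ) = k + 1) (hxy : x < y) :
    Equiv.swap k l x < Equiv.swap k l y ∨ (x = k ∧ y = l) := by
  simp only [Equiv.swap_apply_def, Fin.lt_def, Fin.ext_iff] at *
  split_ifs <;> omega

lemma LeKer.image_swap (hker : LeKer idx P) (k l : Fin n) :
    LeKer (idx ∘ Equiv.swap k l) (P.image (Finset.image (Equiv.swap k l))) := by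
  simpa only [Equiv.symm_swap] using hker.image_equiv (Equiv.swap k l)

lemma IsEpsNC.image_swap (hsym : ∀ i j, ε i j = ε j i) (hker : LeKer idx P)
    (h : IsEpsNC ε idx P) (hkl : (l : ℕ) = k + 1) (hε : ε (idx k) (idx l) = true) :
    IsEpsNC ε (idx ∘ Equiv.swap k l) (P.image (Finset.image (Equiv.swap k l))) := by
  intro p₁ q₁ p₂ q₂ h₁ h₂ h₃ hp hq hpq
  rw [sameBlock_image_equiv, Equiv.symm_swap] at hp hq hpq
  have hp' := hker _ _ hp
  have hq' := hker _ _ hq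
  simp only [Function.comp_apply]
  rcases swap_lt_swap_or_eq hkl h₁ with h₁ | ⟨rfl, rfl⟩
  · rcases swap_lt_swap_or_eq hkl h₂ with h₂ | ⟨rfl, rfl⟩
    · rcases swap_lt_swap_or_eq hkl h₃ with h₃ | ⟨rfl, rfl⟩
      · exact h _ _ _ _ h₁ h₂ h₃ hp hq hpq
      · rw [hp', hq', Equiv.swap_apply_left, Equiv.swap_apply_right, hsym, hε]
    · rw [hp', Equiv.swap_apply_left, Equiv.swap_apply_right, hε]
  · rw [Equiv.swap_apply_left, Equiv.swap_apply_right, hsym, hε]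

lemma IsEpsNC.of_image_swap (hsym : ∀ i j, ε i j = ε j i) (hker : LeKer idx P)
    (hkl : (l : ℕ) = k + 1) (hε : ε (idx k) (idx l) = true)
    (h : IsEpsNC ε (idx ∘ Equiv.swap k l) (P.image (Finset.image (Equiv.swap k l)))) :
    IsEpsNC ε idx P := by
  have key := h.image_swap hsym (hker.image_swap k l) hkl (by simp [hsym (idx l), hε])
  have hσ : ⇑(Equiv.swap k l) ∘ ⇑(Equiv.swap k l) = id := by
    funext x
    simp
  have hσ' : Finset.image (Equiv.swap k l) ∘ Finset.image (Equiv.swap k l) = id := by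
    funext V
    simp [Finset.image_image, hσ]
  rwa [Function.comp_assoc, hσ, Function.comp_id, Finset.image_image, hσ', Finset.image_id]
    at key

end AdjacentSwap

/-- Every point lying strictly between two points of `V` but outside `V` carries an index
commuting with the indices of these two points. -/
def CommutesWithGaps {I : Type*} (ε : I → I → Bool) {n : ℕ} (idx : Fin n → I)
    (V : Finset (Fin n)) : Prop :=
  ∀ a ∈ V, ∀ b ∈ V, ∀ x ∉ V, a < x → x < b → ε (idx a) (idx x) = true

section CommutesWithGaps

variable {I : Type*} {ε : I → I → Bool} {n : ℕ} {idx : Fin n → I}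
  {P : Finset (Finset (Fin n))} {V : Finset (Fin n)} {k l : Fin n}

/-- A block whose hull is of minimal size commutes with its gaps: any other block meeting
the hull is not contained in it, hence crosses the given block. -/
lemma IsEpsNC.exists_commutesWithGaps (hsym : ∀ i j, ε i j = ε j i) (hP : IsPartition P)
    (hker : LeKer idx P) (h : IsEpsNC ε idx P) (hne : P.Nonempty) :
    ∃ V ∈ P, CommutesWithGaps ε idx V := by
  let hull (V : Finset (Fin n)) : Finset (Fin n) :=
    {x | (∃ a ∈ V, a ≤ x) ∧ ∃ b ∈ V, x ≤ b}
  obtain ⟨V, hV, hmin⟩ := P.exists_min_image (fun V => #(hull V)) hne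
  refine ⟨V, hV, fun a ha b hb x hx hax hxb => ?_⟩
  obtain ⟨W, ⟨hW, hxW⟩, -⟩ := hP.2 x
  have hdisj {v w : Fin n} (hv : v ∈ V) (hw : w ∈ W) : v ≠ w := by
    rintro rfl
    exact hx (hP.eq_of_mem hV hW hv hw ▸ hxW)
  have hnot {v w : Fin n} (hv : v ∈ V) (hw : w ∈ W) : ¬ SameBlock P v w := fun hvw =>
    hdisj (hP.mem_of_sameBlock hV hv hvw) hw rfl
  by_contra hε
  have hlow {w : Fin n} (hw : w ∈ W) : a < w := by
    refine lt_of_le_of_ne (not_lt.1 fun hwa => hε ?_) (hdisj ha hw)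
    rw [hsym, ← hker w x ⟨W, hW, hw, hxW⟩]
    exact h w a x b hwa hax hxb ⟨W, hW, hw, hxW⟩ ⟨V, hV, ha, hb⟩
      (fun hs => hnot ha hw hs.symm)
  have hhigh {w : Fin n} (hw : w ∈ W) : w < b :=
    lt_of_le_of_ne (not_lt.1 fun hbw => hε
      (h a x b w hax hxb hbw ⟨V, hV, ha, hb⟩ ⟨W, hW, hxW, hw⟩ (hnot ha hxW)))
      (hdisj hb hw).symm
  refine (hmin W hW).not_gt (Finset.card_lt_card ⟨fun y hy => ?_, fun hsub => ?_⟩)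
  · obtain ⟨⟨c, hc, hcy⟩, d, hd, hyd⟩ := (Finset.mem_filter.1 hy).2
    exact Finset.mem_filter.2 ⟨Finset.mem_univ _, ⟨a, ha, (hlow hc).le.trans hcy⟩,
      b, hb, hyd.trans (hhigh hd).le⟩
  · have haV : a ∈ hull V :=
      Finset.mem_filter.2 ⟨Finset.mem_univ _, ⟨a, ha, le_rfl⟩, a, ha, le_rfl⟩
    obtain ⟨⟨c, hc, hca⟩, -⟩ := (Finset.mem_filter.1 (hsub haV)).2
    exact (hlow hc).not_ge hca

lemma CommutesWithGaps.image_swap (hsym : ∀ i j, ε i j = ε j i)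
    (h : CommutesWithGaps ε idx V) (hV : ∀ a ∈ V, ∀ b ∈ V, idx a = idx b)
    (hkl : (l : ℕ) = k + 1) (hε : ε (idx k) (idx l) = true) :
    CommutesWithGaps ε (idx ∘ Equiv.swap k l) (V.image (Equiv.swap k l)) := by
  intro a ha b hb x hx hax hxb
  rw [mem_image_equiv_iff, Equiv.symm_swap] at ha hb hx
  simp only [Function.comp_apply]
  rcases swap_lt_swap_or_eq hkl hax with hax | ⟨rfl, rfl⟩
  · rcases swap_lt_swap_or_eq hkl hxb with hxb | ⟨rfl, rfl⟩
    · exact h _ ha _ hb _ hx hax hxb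
    · rw [hV _ ha _ hb, Equiv.swap_apply_left, Equiv.swap_apply_right, hε]
  · rw [Equiv.swap_apply_left, Equiv.swap_apply_right, hsym, hε]

/-- A set with a gap contains a point `k` whose successor `l` lies in a gap. -/
lemma exists_succ_mem_gap {a b x : Fin n} (ha : a ∈ V) (hx : x ∉ V) (hax : a < x)
    (hxb : x < b) : ∃ k l : Fin n, (l : ℕ) = k + 1 ∧ k ∈ V ∧ l ∉ V ∧ l < b := by
  have hne : ({v ∈ V | v < x}).Nonempty := ⟨a, Finset.mem_filter.2 ⟨ha, hax⟩⟩
  obtain ⟨k, hk, hmax⟩ := Finset.exists_max_image {v ∈ V | v < x} id hne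
  obtain ⟨hkV, hkx⟩ := Finset.mem_filter.1 hk
  have hkx' : (k : ℕ) < x := hkx
  have hl : (k : ℕ) + 1 < n := by omega
  have hlx : (⟨k + 1, hl⟩ : Fin n) ≤ x := hkx'
  refine ⟨k, ⟨k + 1, hl⟩, rfl, hkV, fun hlV => ?_, hlx.trans_lt hxb⟩
  have hlx' : (⟨k + 1, hl⟩ : Fin n) < x := lt_of_le_of_ne hlx fun he => hx (he ▸ hlV)
  have hle : (k : ℕ) + 1 ≤ k := hmax _ (Finset.mem_filter.2 ⟨hlV, hlx'⟩)
  omega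

lemma eq_Icc_of_no_gap (hV : V.Nonempty)
    (h : ∀ a ∈ V, ∀ b ∈ V, ∀ x, a < x → x < b → x ∈ V) :
    V = Finset.Icc (V.min' hV) (V.max' hV) := by
  ext x
  refine ⟨fun hx => Finset.mem_Icc.2 ⟨V.min'_le x hx, V.le_max' x hx⟩, fun hx => ?_⟩
  obtain ⟨h₁, h₂⟩ := Finset.mem_Icc.1 hx
  rcases h₁.eq_or_lt with h₁ | h₁
  · exact h₁ ▸ V.min'_mem hV
  rcases h₂.eq_or_lt with h₂ | h₂
  · exact h₂ ▸ V.max'_mem hV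
  exact h _ (V.min'_mem hV) _ (V.max'_mem hV) x h₁ h₂

lemma sum_image_swap_lt (hkl : (l : ℕ) = k + 1) (hk : k ∈ V) (hl : l ∉ V) :
    ∑ v ∈ V.image (Equiv.swap k l), (n - (v : ℕ)) < ∑ v ∈ V, (n - (v : ℕ)) := by
  rw [Finset.sum_image (Equiv.swap k l).injective.injOn]
  refine Finset.sum_lt_sum (fun v hv => ?_) ⟨k, hk, ?_⟩
  · have hvl : v ≠ l := ne_of_mem_of_not_mem hv hl
    by_cases hvk : v = k
    · rw [hvk, Equiv.swap_apply_left]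
      omega
    · rw [Equiv.swap_apply_of_ne_of_ne hvk hvl]
  · rw [Equiv.swap_apply_left]
    omega

end CommutesWithGaps

section Reduction

variable {I : Type*} {ε : I → I → Bool} {n : ℕ} {idx : Fin n → I}
  {P : Finset (Finset (Fin n))}

lemma EpsReducible.isEpsNC (hsym : ∀ i j, ε i j = ε j i) (h : EpsReducible ε idx P)
    (hP : IsPartition P) (hker : LeKer idx P) : IsEpsNC ε idx P := by
  induction h with
  | empty => exact fun p => p.elim0
  | removeInterval idx P r s hrs hB _ ih =>
    exact .of_eraseIcc hP hrs hB (ih (hP.eraseIcc hrs hB) (hker.eraseIcc hrs))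
  | swap idx P k hk hε _ ih =>
    exact .of_image_swap hsym hker rfl hε (ih (hP.image_equiv _) (hker.image_swap _ _))

/-- A block commuting with its gaps can be made into an interval by adjacent swaps and then
removed. -/
lemma EpsReducible.of_commutesWithGaps (hsym : ∀ i j, ε i j = ε j i)
    (hrec : ∀ m < n, ∀ (idx : Fin m → I) (P : Finset (Finset (Fin m))),
      IsPartition P → LeKer idx P → IsEpsNC ε idx P → EpsReducible ε idx P)
    (hP : IsPartition P) (hker : LeKer idx P) (h : IsEpsNC ε idx P)
    {V : Finset (Fin n)} (hV : V ∈ P) (hgaps : CommutesWithGaps ε idx V) :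
    EpsReducible ε idx P := by
  induction hm : ∑ v ∈ V, (n - (v : ℕ)) using Nat.strong_induction_on
    generalizing idx P V with
  | _ m ih =>
  by_cases hno : ∀ a ∈ V, ∀ b ∈ V, ∀ x, a < x → x < b → x ∈ V
  · have hne : V.Nonempty := Finset.nonempty_iff_ne_empty.2 (ne_of_mem_of_not_mem hV hP.1)
    have hrs : V.min' hne ≤ V.max' hne := V.min'_le _ (V.max'_mem hne)
    have hB : Finset.Icc (V.min' hne) (V.max' hne) ∈ P := eq_Icc_of_no_gap hne hno ▸ hV
    have hpos := (V.min' hne).pos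
    exact .removeInterval idx P _ _ hrs hB
      (hrec _ (by omega) _ _ (hP.eraseIcc hrs hB) (hker.eraseIcc hrs) (h.eraseIcc hrs))
  · push Not at hno
    obtain ⟨a, ha, b, hb, x, hax, hxb, hx⟩ := hno
    obtain ⟨k, ⟨l, hln⟩, rfl, hk, hl, hlb⟩ := exists_succ_mem_gap ha hx hax hxb
    have hε := hgaps k hk b hb _ hl (Nat.lt_succ_self k) hlb
    exact .swap idx P k hln hε (ih _ (hm ▸ sum_image_swap_lt rfl hk hl) (hP.image_equiv _)
      (hker.image_swap _ _) (h.image_swap hsym hker rfl hε) (Finset.mem_image_of_mem _ hV)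
      (hgaps.image_swap hsym (fun a ha b hb => hker a b ⟨V, hV, ha, hb⟩) rfl hε) rfl)

lemma IsEpsNC.epsReducible (hsym : ∀ i j, ε i j = ε j i) (hP : IsPartition P)
    (hker : LeKer idx P) (h : IsEpsNC ε idx P) : EpsReducible ε idx P := by
  induction n using Nat.strong_induction_on with
  | _ n ih =>
  rcases n.eq_zero_or_pos with rfl | hn
  · rw [hP.eq_empty]
    exact .empty idx
  · obtain ⟨V₀, ⟨hV₀, -⟩, -⟩ := hP.2 ⟨0, hn⟩
    obtain ⟨V, hV, hgaps⟩ := h.exists_commutesWithGaps hsym hP hker ⟨V₀, hV₀⟩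
    exact .of_commutesWithGaps hsym (fun m hm _ _ => ih m hm) hP hker h hV hgaps

end Reduction

/-- A partition `P ≤ ker idx` is `(ε, idx)`-non-crossing if and only
if the pair `(P, idx)` can be reduced to the empty partition of the empty tuple by
iterated removal of interval blocks and exchanges of adjacent points `k, k+1` with
`ε_{idx k, idx (k+1)} = 1`. -/
theorem isEpsNC_iff_epsReducible {I : Type*} (ε : I → I → Bool)
    (hsym : ∀ i j, ε i j = ε j i) (hdiag : ∀ i, ε i i = false)
    (n : ℕ) (idx : Fin n → I) (P : Finset (Finset (Fin n)))
    (hP : IsPartition P) (hker : LeKer idx P) :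
    IsEpsNC ε idx P ↔ EpsReducible ε idx P := by
  exact ⟨fun h => h.epsReducible hsym hP hker, fun h => h.isEpsNC hsym hP hker⟩
end
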